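/- Let T₇ be the tournament on the vertex set Fin 7 = {0,…,6} defined as follows: for i < j the arc goes from i to j, except for the pairs B₇ = {(2,0),(4,2),(6,3),(5,1),(5,0)}, for which the arc goes backward. Then τ(T₇) = 5 and ν(T₇) = 4; in particular ν(T₇) < τ(T₇). -/

import Mathlib

/-- `c` is a directed cycle of the digraph with arc relation `A`:
a list of pairwise distinct vertices, of length at least 3, with consecutive
arcs present and a closing arc from the last vertex back to the first. -/
def IsCycle {V : Type*} (A : V → V → Prop) (c : List V) : Prop :=
  c.Nodup ∧ 3 ≤ c.length ∧ List.Chain' A c ∧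
    ∀ h : c ≠ [], A (c.getLast h) (c.head h)

/-- The set of arcs of the cycle given by the list `c`. -/
def cycleArcs {V : Type*} [DecidableEq V] (c : List V) : Finset (V × V) :=
  (c.zip (c.rotate 1)).toFinset

/-- `S` is a feedback arc set: a set of arcs whose removal leaves an acyclic digraph. -/
def IsFeedbackArcSet {V : Type*} (A : V → V → Prop) (S : Finset (V × V)) : Prop :=
  (∀ e ∈ S, A e.1 e.2) ∧
    ∀ c : List V, ¬ IsCycle (fun x y => A x y ∧ (x, y) ∉ S) c

/-- `τ(D)`: the minimum size of a feedback arc set. -/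
noncomputable def tau {V : Type*} (A : V → V → Prop) : ℕ :=
  sInf {n | ∃ S : Finset (V × V), IsFeedbackArcSet A S ∧ S.card = n}

/-- `ν(D)`: the maximum number of pairwise arc-disjoint directed cycles. -/
noncomputable def nu {V : Type*} [DecidableEq V] (A : V → V → Prop) : ℕ :=
  sSup {n | ∃ C : Fin n → List V, (∀ i, IsCycle A (C i)) ∧
    ∀ i j, i ≠ j → Disjoint (cycleArcs (C i)) (cycleArcs (C j))}

/-- The backward arcs of the tournament `T₇` of Figure 2. -/
def B7 : Finset (Fin 7 × Fin 7) :=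
  {(2,0),(4,2),(6,3),(5,1),(5,0)}

/-- The tournament `T₇` of Figure 2: for `i < j` the arc goes from `i` to `j`,
except for the pairs in `B7`, for which the arc goes backward. -/
def T7 (i j : Fin 7) : Prop :=
  (i < j ∧ (j, i) ∉ B7) ∨ (i, j) ∈ B7

section Cycles

variable {V : Type*} [DecidableEq V] {A : V → V → Prop} {l : List V}

lemma mem_cycleArcs_iff {e : V × V} :
    e ∈ cycleArcs l ↔ ∃ (i : ℕ) (hi : i < l.length),
      e = (l[i], l[(i + 1) % l.length]'(Nat.mod_lt _ (by omega))) := by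
  simp only [cycleArcs, List.mem_toFinset, List.mem_iff_getElem, List.length_zip,
    List.length_rotate, min_self, List.getElem_zip, List.getElem_rotate]
  exact ⟨fun ⟨i, hi, h⟩ => ⟨i, hi, h.symm⟩, fun ⟨i, hi, h⟩ => ⟨i, hi, h.symm⟩⟩

lemma exists_mem_cycleArcs {x : V} (hx : x ∈ l) : ∃ y ∈ l, (x, y) ∈ cycleArcs l := by
  obtain ⟨i, hi, rfl⟩ := List.mem_iff_getElem.1 hx
  exact ⟨_, List.getElem_mem _, mem_cycleArcs_iff.2 ⟨i, hi, rfl⟩⟩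

/-- The cycle condition in terms of the set of arcs. -/
lemma isCycle_iff : IsCycle A l ↔
    l.Nodup ∧ 3 ≤ l.length ∧ ∀ e ∈ cycleArcs l, A e.1 e.2 := by
  unfold IsCycle
  refine and_congr_right fun _ => and_congr_right fun hlen => ?_
  have hne : l ≠ [] := by rintro rfl; simp at hlen
  constructor
  · rintro ⟨hchain, hclose⟩ e he
    obtain ⟨i, hi, rfl⟩ := mem_cycleArcs_iff.1 he
    rcases Nat.lt_or_ge (i + 1) l.length with h | h
    · simpa only [Nat.mod_eq_of_lt h] using List.isChain_iff_getElem.1 hchain i h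
    · obtain rfl : i = l.length - 1 := by omega
      have := hclose hne
      rw [List.getLast_eq_getElem, List.head_eq_getElem] at this
      simpa only [Nat.sub_add_cancel (show 1 ≤ l.length by omega), Nat.mod_self] using this
  · intro h
    refine ⟨List.isChain_iff_getElem.2 fun i hi => ?_, fun _ => ?_⟩
    · simpa only [Nat.mod_eq_of_lt hi] using h _ (mem_cycleArcs_iff.2 ⟨i, by omega, rfl⟩)
    · rw [List.getLast_eq_getElem, List.head_eq_getElem]
      simpa only [Nat.sub_add_cancel (show 1 ≤ l.length by omega), Nat.mod_self] using
        h _ (mem_cycleArcs_iff.2 ⟨l.length - 1, by omega, rfl⟩)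

/-- A function on the vertices cannot increase along every arc of a cycle. -/
lemma IsCycle.exists_arc_le (hc : IsCycle A l) (p : V → ℕ) :
    ∃ e ∈ cycleArcs l, A e.1 e.2 ∧ p e.2 ≤ p e.1 := by
  obtain ⟨-, hlen, harc⟩ := isCycle_iff.1 hc
  have hne : l.toFinset.Nonempty :=
    (List.toFinset_nonempty_iff l).2 (by rintro rfl; simp at hlen)
  obtain ⟨x, hx, hmax⟩ := l.toFinset.exists_max_image p hne
  obtain ⟨y, hy, hxy⟩ := exists_mem_cycleArcs (List.mem_toFinset.1 hx)
  exact ⟨(x, y), hxy, harc _ hxy, hmax y (List.mem_toFinset.2 hy)⟩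

lemma IsFeedbackArcSet.inter_nonempty {S : Finset (V × V)} (hS : IsFeedbackArcSet A S)
    (hc : IsCycle A l) : (S ∩ cycleArcs l).Nonempty := by
  by_contra h
  obtain ⟨hnd, hlen, harc⟩ := isCycle_iff.1 hc
  refine hS.2 l (isCycle_iff.2 ⟨hnd, hlen, fun e he => ⟨harc e he, fun heS => h ?_⟩⟩)
  exact ⟨e, Finset.mem_inter.2 ⟨heS, he⟩⟩

/-- If `n` cycles cover each arc at most `k` times, a feedback arc set has at least `n / k` arcs. -/
lemma IsFeedbackArcSet.le_mul_card {S : Finset (V × V)} (hS : IsFeedbackArcSet A S) {n k : ℕ}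
    (C : Fin n → List V) (hC : ∀ i, IsCycle A (C i))
    (hk : ∀ e, (Finset.univ.filter fun i => e ∈ cycleArcs (C i)).card ≤ k) :
    n ≤ k * S.card := by
  calc n = ∑ _i : Fin n, 1 := by simp
    _ ≤ ∑ i, (S ∩ cycleArcs (C i)).card :=
        Finset.sum_le_sum fun i _ => (hS.inter_nonempty (hC i)).card_pos
    _ = ∑ e ∈ S, (Finset.univ.filter fun i => e ∈ cycleArcs (C i)).card := by
        simp only [← Finset.filter_mem_eq_inter, Finset.card_filter]
        exact Finset.sum_comm
    _ ≤ S.card * k := Finset.sum_le_card_nsmul _ _ _ fun e _ => hk e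
    _ = k * S.card := Nat.mul_comm _ _

/-- If every cycle has at least `k` arcs in `F`, then there are at most `|F| / k` pairwise
arc-disjoint cycles. -/
lemma mul_le_card_of_disjoint {F : Finset (V × V)} {n k : ℕ}
    (hF : ∀ l, IsCycle A l → k ≤ (F ∩ cycleArcs l).card)
    (C : Fin n → List V) (hC : ∀ i, IsCycle A (C i))
    (hd : ∀ i j, i ≠ j → Disjoint (cycleArcs (C i)) (cycleArcs (C j))) :
    n * k ≤ F.card := by
  calc n * k = ∑ _i : Fin n, k := by simp
    _ ≤ ∑ i, (F ∩ cycleArcs (C i)).card := Finset.sum_le_sum fun i _ => hF _ (hC i)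
    _ = (Finset.univ.biUnion fun i => F ∩ cycleArcs (C i)).card :=
        (Finset.card_biUnion fun i _ j _ hij =>
          (hd i j hij).mono Finset.inter_subset_right Finset.inter_subset_right).symm
    _ ≤ F.card := Finset.card_le_card (Finset.biUnion_subset.2 fun _ _ => Finset.inter_subset_left)

end Cycles

instance : DecidableRel T7 := fun i j =>
  inferInstanceAs (Decidable ((i < j ∧ (j, i) ∉ B7) ∨ (i, j) ∈ B7))

/-- Nine cycles of `T₇` that together use each arc at most twice. -/
def halfPacking7 : Fin 9 → List (Fin 7) :=
  ![[0, 1, 2], [0, 1, 2], [0, 3, 5], [0, 4, 5], [1, 4, 5], [2, 3, 4], [3, 4, 6], [3, 5, 6],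
    [1, 4, 2, 5]]

/-- Four pairwise arc-disjoint cycles of `T₇`. -/
def packing7 : Fin 4 → List (Fin 7) :=
  ![[0, 1, 2], [0, 3, 5], [1, 4, 5], [2, 3, 4]]

/-- Nine arcs of `T₇` such that every cycle uses at least two of them. -/
def halfCover7 : Finset (Fin 7 × Fin 7) :=
  {(2, 0), (5, 0), (4, 2), (5, 1), (6, 3), (1, 2), (3, 5), (4, 5), (3, 4)}

/-- `T₇` stays acyclic when all but one of the arcs of `halfCover7` are removed. -/
lemma exists_rank_halfCover7 : ∀ f ∈ halfCover7, ∃ p : Fin 7 → ℕ,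
    ∀ x y, T7 x y → p y ≤ p x → (x, y) ∈ halfCover7.erase f := by
  intro f hf
  simp only [halfCover7, Finset.mem_insert, Finset.mem_singleton] at hf
  rcases hf with rfl | rfl | rfl | rfl | rfl | rfl | rfl | rfl | rfl
  · exact ⟨![1, 2, 0, 3, 3, 1, 4], by decide⟩
  · exact ⟨![2, 3, 0, 4, 4, 1, 5], by decide⟩
  · exact ⟨![0, 1, 3, 4, 2, 4, 5], by decide⟩
  · exact ⟨![0, 2, 0, 3, 3, 1, 4], by decide⟩
  · exact ⟨![0, 1, 0, 4, 2, 1, 3], by decide⟩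
  · exact ⟨![0, 1, 2, 3, 2, 3, 4], by decide⟩
  · exact ⟨![0, 1, 0, 2, 2, 3, 4], by decide⟩
  · exact ⟨![0, 1, 0, 2, 2, 3, 4], by decide⟩
  · exact ⟨![0, 1, 0, 2, 3, 1, 4], by decide⟩

lemma two_le_card_halfCover7_inter {c : List (Fin 7)} (hc : IsCycle T7 c) :
    2 ≤ (halfCover7 ∩ cycleArcs c).card := by
  have key : ∀ f ∈ halfCover7, ∃ e ∈ halfCover7 ∩ cycleArcs c, e ≠ f := by
    intro f hf
    obtain ⟨p, hp⟩ := exists_rank_halfCover7 f hf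
    obtain ⟨e, he, hA, hle⟩ := hc.exists_arc_le p
    have := Finset.mem_erase.1 (hp _ _ hA hle)
    exact ⟨e, Finset.mem_inter.2 ⟨this.2, he⟩, this.1⟩
  obtain ⟨f, hf, -⟩ := key (2, 0) (by decide)
  obtain ⟨e, he, hef⟩ := key f (Finset.mem_inter.1 hf).1
  exact Finset.one_lt_card.2 ⟨e, he, f, hf, hef⟩

lemma isFeedbackArcSet_B7 : IsFeedbackArcSet T7 B7 := by
  refine ⟨by decide, fun c hc => ?_⟩
  obtain ⟨e, -, ⟨hA, hB⟩, hle⟩ := hc.exists_arc_le fun x => (x : ℕ)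
  rcases hA with h | h
  · exact absurd h.1 (not_lt.2 hle)
  · exact hB h

lemma tau_T7 : tau T7 = 5 := by
  refine le_antisymm (Nat.sInf_le ⟨B7, isFeedbackArcSet_B7, by decide⟩) ?_
  refine le_csInf ⟨5, B7, isFeedbackArcSet_B7, by decide⟩ ?_
  rintro n ⟨S, hS, rfl⟩
  have := hS.le_mul_card (k := 2) halfPacking7
    (fun i => isCycle_iff.2 (by revert i; decide)) (by decide)
  omega

lemma nu_T7 : nu T7 = 4 := by
  refine IsGreatest.csSup_eq ⟨⟨packing7, fun i => isCycle_iff.2 (by revert i; decide),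
    by decide⟩, ?_⟩
  rintro n ⟨C, hC, hd⟩
  have h := mul_le_card_of_disjoint (fun _ => two_le_card_halfCover7_inter) C hC hd
  have hcard : halfCover7.card = 9 := by decide
  omega

/-- Remark 2: `τ(T₇) = 5` and `ν(T₇) = 4`; in particular `ν(T₇) < τ(T₇)`. -/
theorem remark2_T7 : tau T7 = 5 ∧ nu T7 = 4 ∧ nu T7 < tau T7 := by
  simp [tau_T7, nu_T7]
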